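/- Let K be a field and let (A, d) be a dg K-algebra which is finite-dimensional and central simple as a K-algebra (i.e., A is a simple ring with center K). Then (A, d) ⊗_K (A^op, d) ≅ End•_K(C) as dg K-algebras, where C is the underlying bounded complex (A, d) of finite-dimensional K-vector spaces. In particular, (A, d) ⊗_K (A^op, d) is isomorphic as a dg K-algebra to the matrix algebra Mat_{dim_K A}(K) equipped with some ℤ-grading and differential. -/

import Mathlib

open scoped TensorProduct DirectSum

/-- The predicate that `(𝒞, dC)` is a (cochain) complex structure on the `ℤ`-graded
`K`-module `C`: the differential has degree `+1` and squares to zero. -/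
structure IsComplex {K C : Type} [Field K] [AddCommGroup C] [Module K C]
    (𝒞 : ℤ → Submodule K C) (dC : C →ₗ[K] C) : Prop where
  map_mem : ∀ n : ℤ, ∀ x ∈ 𝒞 n, dC x ∈ 𝒞 (n + 1)
  sq : ∀ x : C, dC (dC x) = 0

/-- The predicate that `d` makes the `ℤ`-graded `K`-algebra `(A, 𝒜)` into a differential
graded `K`-algebra: `d` has degree `+1`, squares to zero, and satisfies the graded Leibniz
rule `d (a * b) = d a * b + (-1)^{|a|} • (a * d b)` on homogeneous elements. -/
structure IsDGAlgebra {K A : Type} [Field K] [Ring A] [Algebra K A]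
    (𝒜 : ℤ → Submodule K A) (d : A →ₗ[K] A) : Prop where
  map_mem : ∀ n : ℤ, ∀ a ∈ 𝒜 n, d a ∈ 𝒜 (n + 1)
  sq : ∀ a : A, d (d a) = 0
  leibniz : ∀ m n : ℤ, ∀ a ∈ 𝒜 m, ∀ b ∈ 𝒜 n,
    d (a * b) = d a * b + ((-1 : K) ^ m.natAbs) • (a * d b)

/-- The degree-`n` component of `End•_K(C)`: all `K`-linear endomorphisms of `C` that
shift degrees by `n`. -/
def endGrading (K : Type) {C : Type} [Field K] [AddCommGroup C] [Module K C]
    (𝒞 : ℤ → Submodule K C) (n : ℤ) : Submodule K (Module.End K C) where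
  carrier := {f | ∀ k : ℤ, ∀ x ∈ 𝒞 k, f x ∈ 𝒞 (k + n)}
  add_mem' := fun hf hg k x hx => add_mem (hf k x hx) (hg k x hx)
  zero_mem' := fun k x _ => by simp
  smul_mem' := fun c f hf k x hx => Submodule.smul_mem _ c (hf k x hx)

/-- The sign operator on a `ℤ`-graded module: multiplication by `(-1)^n` on the
degree-`n` component. -/
noncomputable def signOp (K : Type) {C : Type} [Field K] [AddCommGroup C] [Module K C]
    (𝒞 : ℤ → Submodule K C) [DirectSum.Decomposition 𝒞] : Module.End K C :=
  (DirectSum.toModule K ℤ C fun n => ((-1 : K) ^ n.natAbs) • (𝒞 n).subtype) ∘ₗ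
    (DirectSum.decomposeLinearEquiv 𝒞).toLinearMap

/-- The differential `d_Hom` on `End•_K(C)`, given on a homogeneous `f` of degree `|f|` by
`d_Hom f = d_C ∘ f - (-1)^{|f|} f ∘ d_C`; it is expressed via the sign operator
(`(-1)^{|f|} f = ε ∘ f ∘ ε` on homogeneous `f`) so as to be globally linear in `f`. -/
noncomputable def endDiff (K : Type) {C : Type} [Field K] [AddCommGroup C] [Module K C]
    (𝒞 : ℤ → Submodule K C) [DirectSum.Decomposition 𝒞] (dC : C →ₗ[K] C) :
    Module.End K C →ₗ[K] Module.End K C where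
  toFun f := dC ∘ₗ f - signOp K 𝒞 ∘ₗ f ∘ₗ signOp K 𝒞 ∘ₗ dC
  map_add' f g := by
    simp only [LinearMap.comp_add, LinearMap.add_comp]; abel
  map_smul' c f := by
    simp only [LinearMap.comp_smul, LinearMap.smul_comp, RingHom.id_apply, smul_sub]

/-- An isomorphism of differential graded `K`-algebras: an algebra isomorphism which is
degree-preserving and intertwines the differentials. -/
structure IsDGIso {K A B : Type} [Field K] [Ring A] [Algebra K A] [Ring B] [Algebra K B]
    (𝒜 : ℤ → Submodule K A) (ℬ : ℤ → Submodule K B)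
    (dA : A →ₗ[K] A) (dB : B →ₗ[K] B) (e : A ≃ₐ[K] B) : Prop where
  map_grading : ∀ n : ℤ, (𝒜 n).map (e : A →ₗ[K] B) = ℬ n
  map_diff : ∀ a : A, e (dA a) = dB (e a)

/-- A bounded complex of finite-dimensional `K`-vector spaces (boundedness is automatic
from finite-dimensionality), bundled with the graded-algebra structure on its
endomorphism algebra. -/
structure FinComplex (K : Type) [Field K] where
  carrier : Type
  [acg : AddCommGroup carrier]
  [mod : Module K carrier]
  [findim : FiniteDimensional K carrier]
  grading : ℤ → Submodule K carrier
  [decomp : DirectSum.Decomposition grading]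
  diff : carrier →ₗ[K] carrier
  complex : IsComplex grading diff
  [endGraded : GradedAlgebra (endGrading K grading)]

attribute [instance] FinComplex.acg FinComplex.mod FinComplex.findim FinComplex.decomp
  FinComplex.endGraded

section TensorDG

variable (K : Type) [Field K] {A B : Type} [Ring A] [Algebra K A] [Ring B] [Algebra K B]
  (𝒜 : ℤ → Submodule K A) (ℬ : ℤ → Submodule K B) [GradedAlgebra 𝒜] [GradedAlgebra ℬ]

/-- The degree-`n` component of the graded (Koszul-signed) tensor product `𝒜 ᵍ⊗[K] ℬ`:
the span of the `a ⊗ b` with `a, b` homogeneous and `|a| + |b| = n`. -/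
noncomputable def gtGrading (n : ℤ) : Submodule K (𝒜 ᵍ⊗[K] ℬ) :=
  Submodule.span K {x | ∃ i j : ℤ, i + j = n ∧ ∃ a ∈ 𝒜 i, ∃ b ∈ ℬ j, x = a ᵍ⊗ₜ[K] b}

/-- The differential of the tensor product of differential graded algebras:
`d (a ⊗ b) = dA a ⊗ b + (-1)^{|a|} a ⊗ dB b` for `a` homogeneous. -/
noncomputable def gtDiff (dA : A →ₗ[K] A) (dB : B →ₗ[K] B) :
    (𝒜 ᵍ⊗[K] ℬ) →ₗ[K] (𝒜 ᵍ⊗[K] ℬ) :=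
  (GradedTensorProduct.of K 𝒜 ℬ).toLinearMap ∘ₗ
    (TensorProduct.map dA LinearMap.id + TensorProduct.map (signOp K 𝒜) dB) ∘ₗ
      (GradedTensorProduct.of K 𝒜 ℬ).symm.toLinearMap

end TensorDG

/-- Two differential graded `K`-algebras `(A, 𝒜, dA)` and `(B, ℬ, dB)` are *equivalent*
if there are bounded complexes `C₁`, `C₂` of finite-dimensional `K`-vector spaces such
that `A ⊗_K End•_K(C₁) ≅ B ⊗_K End•_K(C₂)` as differential graded `K`-algebras. -/
noncomputable def DGEquivalent (K : Type) [Field K] {A B : Type}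
    [Ring A] [Algebra K A] [Ring B] [Algebra K B]
    (𝒜 : ℤ → Submodule K A) (ℬ : ℤ → Submodule K B)
    (gA : GradedAlgebra 𝒜) (gB : GradedAlgebra ℬ)
    (dA : A →ₗ[K] A) (dB : B →ₗ[K] B) : Prop :=
  ∃ C₁ C₂ : FinComplex K,
    ∃ e : (𝒜 ᵍ⊗[K] endGrading K C₁.grading) ≃ₐ[K] (ℬ ᵍ⊗[K] endGrading K C₂.grading),
      IsDGIso (gtGrading K 𝒜 (endGrading K C₁.grading))
        (gtGrading K ℬ (endGrading K C₂.grading))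
        (gtDiff K 𝒜 (endGrading K C₁.grading) dA (endDiff K C₁.grading C₁.diff))
        (gtDiff K ℬ (endGrading K C₂.grading) dB (endDiff K C₂.grading C₂.diff)) e

namespace CentralSimple

variable {K A : Type*} [Field K] [Ring A] [Algebra K A]

theorem isSimpleModule_of_mul_mem [IsSimpleRing A] (S : Subalgebra K (Module.End K A))
    (hl : ∀ a, LinearMap.mulLeft K a ∈ S) (hr : ∀ a, LinearMap.mulRight K a ∈ S) :
    IsSimpleModule S A := by
  have hbt := (isSimpleRing_iff_isTwoSided_imp (R := A)).1 inferInstance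
  have := hbt.1
  rw [isSimpleModule_iff]
  refine { eq_bot_or_eq_top := fun N => ?_ }
  let I : Ideal A :=
    { carrier := N
      add_mem' := N.add_mem
      zero_mem' := N.zero_mem
      smul_mem' := fun a x hx => N.smul_mem (⟨_, hl a⟩ : S) hx }
  have hI : I.IsTwoSided := ⟨fun {x} b hx => N.smul_mem (⟨_, hr b⟩ : S) hx⟩
  refine (hbt.2 I hI).imp (fun h => ?_) (fun h => ?_)
  · ext x; exact SetLike.ext_iff.1 h x
  · ext x; exact SetLike.ext_iff.1 h x

/-- In a central simple algebra, the left and right multiplications generate all endomorphisms. -/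
theorem eq_top_of_mul_mem [FiniteDimensional K A] [Algebra.IsCentral K A] [IsSimpleRing A]
    (S : Subalgebra K (Module.End K A))
    (hl : ∀ a, LinearMap.mulLeft K a ∈ S) (hr : ∀ a, LinearMap.mulRight K a ∈ S) : S = ⊤ := by
  classical
  have := isSimpleModule_of_mul_mem S hl hr
  refine eq_top_iff.2 fun f _ => ?_
  have hscalar (g : Module.End S A) : ∃ c : K, ∀ x, g x = c • x := by
    have h1 (x : A) : g x = x * g 1 := by
      have : g (x * 1) = x * g 1 := g.map_smul (⟨_, hl x⟩ : S) 1
      rwa [mul_one] at this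
    have h2 (x : A) : g x = g 1 * x := by
      have : g (1 * x) = g 1 * x := g.map_smul (⟨_, hr x⟩ : S) 1
      rwa [one_mul] at this
    have hc : g 1 ∈ Subalgebra.center K A :=
      Subalgebra.mem_center_iff.2 fun x => (h1 x).symm.trans (h2 x)
    obtain ⟨c, hc⟩ := Algebra.mem_bot.1 (Algebra.IsCentral.out hc)
    exact ⟨c, fun x => by rw [h2, ← hc, Algebra.smul_def]⟩
  let F : Module.End (Module.End S A) A :=
    { toFun := f
      map_add' := f.map_add
      map_smul' := fun g x => by
        obtain ⟨c, hc⟩ := hscalar g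
        simp [hc] }
  let b := Module.finBasis K A
  obtain ⟨r, hr⟩ := jacobson_density (R := S) F (Finset.univ.image b)
  have : f = r := b.ext fun i => hr (b i) (by simp)
  exact this ▸ r.2

/-- The endomorphism `x ↦ ∑ i, e i * x * b i` attached to a family `e`. -/
noncomputable def sumMul {ι : Type*} [Fintype ι] (b : ι → A) : (ι → A) →ₗ[K] Module.End K A :=
  ∑ i, (LinearMap.mulRight K (b i)).compRight K ∘ₗ LinearMap.mul K A ∘ₗ LinearMap.proj i

theorem sumMul_apply {ι : Type*} [Fintype ι] (b e : ι → A) (x : A) :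
    sumMul (K := K) b e x = ∑ i, e i * x * b i := by
  simp [sumMul]

theorem sumMul_bijective [FiniteDimensional K A] [Algebra.IsCentral K A] [IsSimpleRing A]
    {ι : Type*} [Fintype ι] (b : Module.Basis ι K A) :
    Function.Bijective (sumMul (K := K) b) := by
  classical
  have key (a c : A) : LinearMap.mulLeft K a * LinearMap.mulRight K c ∈
      (sumMul (K := K) b).range := by
    refine ⟨fun i => b.repr c i • a, LinearMap.ext fun x => ?_⟩
    rw [sumMul_apply]
    calc ∑ i, b.repr c i • a * x * b i = a * x * ∑ i, b.repr c i • b i := by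
          simp only [Finset.mul_sum, mul_smul_comm, smul_mul_assoc]
      _ = _ := by simp [b.sum_repr, mul_assoc]
  have hmul (a c : A) (f : Module.End K A) (hf : f ∈ (sumMul (K := K) b).range) :
      LinearMap.mulLeft K a * LinearMap.mulRight K c * f ∈ (sumMul (K := K) b).range := by
    obtain ⟨e, rfl⟩ := hf
    have : LinearMap.mulLeft K a * LinearMap.mulRight K c * sumMul b e =
        ∑ i, LinearMap.mulLeft K (a * e i) * LinearMap.mulRight K (b i * c) := by
      ext x
      simp [sumMul_apply, mul_assoc]
    rw [this]
    exact sum_mem fun i _ => key _ _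
  let S : Subalgebra K (Module.End K A) :=
    { (sumMul (K := K) b).range with
      one_mem' := by simpa using! key 1 1
      algebraMap_mem' := fun c => by
        have := (sumMul (K := K) b).range.smul_mem c (key 1 1)
        simpa [Algebra.algebraMap_eq_smul_one] using! this
      mul_mem' := by
        rintro _ g ⟨e, rfl⟩ hg
        have : sumMul (K := K) b e * g =
            ∑ i, LinearMap.mulLeft K (e i) * LinearMap.mulRight K (b i) * g := by
          ext x
          simp [sumMul_apply, mul_assoc]
        change _ ∈ (sumMul (K := K) b).range
        rw [this]
        exact sum_mem fun i _ => hmul _ _ _ hg }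
  have hS : S = ⊤ := eq_top_of_mul_mem S (fun a => by simpa using! key a 1)
    (fun a => by simpa using! key 1 a)
  have hsurj : Function.Surjective (sumMul (K := K) b) := fun f =>
    show f ∈ S by rw [hS]; trivial
  refine ⟨(LinearMap.injective_iff_surjective_of_finrank_eq_finrank ?_).2 hsurj, hsurj⟩
  rw [Module.finrank_linearMap, Module.finrank_pi_fintype]
  simp [Module.finrank_eq_card_basis b]

/-- Skolem–Noether for an algebra endomorphism of a central simple algebra. -/
theorem exists_unit_conj [FiniteDimensional K A] [Algebra.IsCentral K A] [IsSimpleRing A]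
    (s : A →ₐ[K] A) (hs : Function.Surjective s) : ∃ u : Aˣ, ∀ x, s x * u = u * x := by
  let b := Module.finBasis K A
  obtain ⟨e, he⟩ := (sumMul_bijective b).2 s.toLinearMap
  have he' (x : A) : ∑ i, e i * x * b i = s x := by rw [← sumMul_apply (K := K), he]; rfl
  have hcomm (a : A) (i) : e i * a = s a * e i := by
    have : (fun i => e i * a) = fun i => s a * e i := (sumMul_bijective b).1 <| by
      ext x
      simp only [sumMul_apply, mul_assoc, ← Finset.mul_sum]
      simp only [← mul_assoc]
      rw [he', ← map_mul, ← he']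
      simp [mul_assoc]
    exact congr_fun this i
  obtain ⟨i, hi⟩ : ∃ i, e i ≠ 0 := by
    by_contra! h
    simpa [h] using he' 1
  let I : Ideal A := Ideal.span {e i}
  have hI : I.IsTwoSided := ⟨fun {x} c hx => by
    obtain ⟨y, rfl⟩ := Ideal.mem_span_singleton'.1 hx
    rw [mul_assoc, hcomm, ← mul_assoc]
    exact Ideal.mul_mem_left _ _ (Ideal.mem_span_singleton_self _)⟩
  have hI' : I = ⊤ := ((isSimpleRing_iff_isTwoSided_imp.1 ‹_›).2 I hI).resolve_left fun h =>
    hi (by simpa [I] using h)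
  obtain ⟨y, hy⟩ := Ideal.mem_span_singleton'.1 (hI'.symm ▸ Submodule.mem_top : (1 : A) ∈ I)
  obtain ⟨z, rfl⟩ := hs y
  rw [← hcomm] at hy
  have h2 : z * e i = 1 := by
    obtain ⟨w, hw⟩ : ∃ w, w * e i = 1 :=
      Ideal.mem_span_singleton'.1 (hI'.symm ▸ Submodule.mem_top : (1 : A) ∈ I)
    rwa [← left_inv_eq_right_inv hw hy]
  exact ⟨⟨e i, z, hy, h2⟩, fun x => (hcomm x i).symm⟩

end CentralSimple

section SignOp

variable {K A : Type} [Field K] [Ring A] [Algebra K A] (𝒜 : ℤ → Submodule K A) [GradedAlgebra 𝒜]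

theorem neg_one_pow_natAbs (n : ℤ) : (-1 : K) ^ n.natAbs = (-1 : K) ^ n := by
  obtain h | h := n.natAbs_eq
  · conv_rhs => rw [h, zpow_natCast]
  · conv_rhs => rw [h, zpow_neg, zpow_natCast, ← inv_pow, inv_neg_one]

theorem neg_one_pow_natAbs_mul (m n : ℤ) :
    (-1 : K) ^ (m.natAbs * n.natAbs) = (-1 : K) ^ (m * n) := by
  rw [← Int.natAbs_mul, neg_one_pow_natAbs]

theorem neg_one_zpow_mul_self (n : ℤ) : (-1 : K) ^ n * (-1 : K) ^ n = 1 := by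
  rw [← mul_zpow]; simp

/-- Linear maps out of a graded module agree if they agree on homogeneous elements. -/
theorem LinearMap.ext_homogeneous {M : Type*} [AddCommGroup M] [Module K M] {f g : A →ₗ[K] M}
    (h : ∀ n, ∀ x ∈ 𝒜 n, f x = g x) : f = g := by
  ext x
  induction x using DirectSum.Decomposition.inductionOn 𝒜 with
  | zero => simp
  | homogeneous x => exact h _ _ x.2
  | add x y hx hy => simp [hx, hy]

variable {𝒜} in
theorem signOp_of_mem {n : ℤ} {x : A} (hx : x ∈ 𝒜 n) : signOp K 𝒜 x = (-1 : K) ^ n • x := by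
  lift x to 𝒜 n using hx
  simp [signOp, neg_one_pow_natAbs]

theorem signOp_signOp (x : A) : signOp K 𝒜 (signOp K 𝒜 x) = x := by
  suffices signOp K 𝒜 ∘ₗ signOp K 𝒜 = LinearMap.id from LinearMap.congr_fun this x
  refine LinearMap.ext_homogeneous 𝒜 fun n x hx => ?_
  simp [signOp_of_mem hx, smul_smul, neg_one_zpow_mul_self]

theorem signOp_mul (x y : A) : signOp K 𝒜 (x * y) = signOp K 𝒜 x * signOp K 𝒜 y := by
  suffices (LinearMap.mul K A).compr₂ (signOp K 𝒜) =
      (LinearMap.mul K A).compl₁₂ (signOp K 𝒜) (signOp K 𝒜) from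
    LinearMap.congr_fun₂ this x y
  refine LinearMap.ext_homogeneous 𝒜 fun m x hx => LinearMap.ext_homogeneous 𝒜 fun n y hy => ?_
  simp [signOp_of_mem hx, signOp_of_mem hy, signOp_of_mem (SetLike.mul_mem_graded hx hy),
    smul_smul, zpow_add₀, mul_comm]

/-- The sign operator of a graded algebra is an algebra automorphism. -/
noncomputable def signAlgHom : A →ₐ[K] A :=
  AlgHom.ofLinearMap (signOp K 𝒜) (by simp [signOp_of_mem (SetLike.one_mem_graded 𝒜)])
    (signOp_mul 𝒜)

/-- Koszul-signed right multiplication: `x ↦ (-1)^{|a||x|} x * a` for homogeneous `a` and `x`. -/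
noncomputable def signedMulRight : A →ₗ[K] Module.End K A :=
  (DirectSum.toModule K ℤ (Module.End K A) fun n =>
      LinearMap.lcomp K A (signOp K 𝒜 ^ n.natAbs) ∘ₗ (LinearMap.mul K A).flip ∘ₗ (𝒜 n).subtype) ∘ₗ
    (DirectSum.decomposeLinearEquiv 𝒜).toLinearMap

variable {𝒜}

theorem signedMulRight_of_mem {n : ℤ} {a : A} (ha : a ∈ 𝒜 n) (x : A) :
    signedMulRight 𝒜 a x = (signOp K 𝒜 ^ n.natAbs) x * a := by
  lift a to 𝒜 n using ha
  simp [signedMulRight]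

theorem signOp_pow_of_mem (k : ℕ) {n : ℤ} {x : A} (hx : x ∈ 𝒜 n) :
    (signOp K 𝒜 ^ k) x = ((-1 : K) ^ n) ^ k • x := by
  induction k with
  | zero => simp
  | succ k ih => simp [pow_succ', ih, signOp_of_mem hx, smul_smul, mul_comm]

theorem signedMulRight_of_mem_of_mem {m n : ℤ} {a x : A} (ha : a ∈ 𝒜 n) (hx : x ∈ 𝒜 m) :
    signedMulRight 𝒜 a x = (-1 : K) ^ (m * n) • (x * a) := by
  rw [signedMulRight_of_mem ha, signOp_pow_of_mem _ hx, smul_mul_assoc, ← neg_one_pow_natAbs,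
    ← pow_mul, neg_one_pow_natAbs_mul]

theorem signedMulRight_of_even {n : ℤ} (hn : Even n) {a : A} (ha : a ∈ 𝒜 n) :
    signedMulRight 𝒜 a = LinearMap.mulRight K a :=
  LinearMap.ext_homogeneous 𝒜 fun m x hx => by
    simp [signedMulRight_of_mem_of_mem ha hx, (hn.mul_left m).neg_one_zpow]

theorem two_smul_signedMulRight (a x : A) :
    (2 : K) • signedMulRight 𝒜 a x =
      x * (a + signOp K 𝒜 a) + signOp K 𝒜 x * (a - signOp K 𝒜 a) := by
  suffices (2 : K) • signedMulRight 𝒜 =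
      (LinearMap.mul K A).flip ∘ₗ (LinearMap.id + signOp K 𝒜) +
        LinearMap.lcomp K A (signOp K 𝒜) ∘ₗ (LinearMap.mul K A).flip ∘ₗ
          (LinearMap.id - signOp K 𝒜) from
    LinearMap.congr_fun₂ this a x
  refine LinearMap.ext_homogeneous 𝒜 fun n a ha => LinearMap.ext_homogeneous 𝒜 fun m x hx => ?_
  simp only [LinearMap.smul_apply, signedMulRight_of_mem_of_mem ha hx, LinearMap.add_apply,
    LinearMap.comp_apply, LinearMap.flip_apply, LinearMap.mul_apply', LinearMap.id_apply,
    LinearMap.sub_apply, LinearMap.lcomp_apply, signOp_of_mem ha, signOp_of_mem hx, mul_add,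
    mul_sub, mul_smul_comm, smul_mul_assoc]
  obtain hn | hn := Int.even_or_odd n
  · rw [(hn.mul_left m).neg_one_zpow, hn.neg_one_zpow]
    module
  · rw [mul_comm m, zpow_mul, hn.neg_one_zpow]
    module

/-- The subalgebra generated by left and signed right multiplications is everything. -/
theorem eq_top_of_signedMulRight_mem [FiniteDimensional K A] [Algebra.IsCentral K A]
    [IsSimpleRing A] (S : Subalgebra K (Module.End K A))
    (hl : ∀ a, LinearMap.mulLeft K a ∈ S) (hr : ∀ a, signedMulRight 𝒜 a ∈ S) : S = ⊤ := by
  refine CentralSimple.eq_top_of_mul_mem S hl fun a => ?_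
  induction a using DirectSum.Decomposition.inductionOn 𝒜 with
  | zero => simp
  | add x y hx hy =>
    have : LinearMap.mulRight K (x + y) = LinearMap.mulRight K x + LinearMap.mulRight K y := by
      ext; simp [mul_add]
    exact this ▸ add_mem hx hy
  | @homogeneous n b =>
    obtain hn | hn := Int.even_or_odd n
    · exact signedMulRight_of_even hn b.2 ▸ hr b
    by_cases h2 : (2 : K) = 0
    · have h1 : (-1 : K) = 1 := by linear_combination -h2
      have : signedMulRight 𝒜 (b : A) = LinearMap.mulRight K (b : A) :=
        LinearMap.ext_homogeneous 𝒜 fun m x hx => by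
          simp [signedMulRight_of_mem_of_mem b.2 hx, h1]
      exact this ▸ hr b
    obtain ⟨u, hu⟩ := CentralSimple.exists_unit_conj (signAlgHom 𝒜)
      (fun x => ⟨signOp K 𝒜 x, signOp_signOp 𝒜 x⟩)
    replace hu : ∀ x, signOp K 𝒜 x * u = u * x := hu
    have huu : signOp K 𝒜 (u : A) = u := u.isUnit.mul_right_cancel (hu u)
    have hub : signOp K 𝒜 (u * (b : A)) = -(u * (b : A)) := by
      rw [signOp_mul, huu, signOp_of_mem b.2, hn.neg_one_zpow]
      simp
    have : LinearMap.mulRight K (b : A) =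
        LinearMap.mulLeft K (↑u⁻¹ : A) * signedMulRight 𝒜 (u * (b : A)) := by
      ext x
      have h := two_smul_signedMulRight (𝒜 := 𝒜) (u * (b : A)) x
      rw [hub, add_neg_cancel, mul_zero, zero_add, sub_neg_eq_add, ← two_smul K, mul_smul_comm,
        ← mul_assoc, hu] at h
      have h' := smul_right_injective A h2 h
      simp [h', mul_assoc]
    exact this ▸ mul_mem (hl _) (hr _)

end SignOp

section KoszulOpposite

theorem apply_mem_iff_of_map_eq {K A B : Type} [Field K] [Ring A] [Algebra K A]
    [Ring B] [Algebra K B] {𝒜 : ℤ → Submodule K A} {ℬ : ℤ → Submodule K B} {σ : A ≃ₗ[K] B}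
    (hσgr : ∀ n : ℤ, (𝒜 n).map σ.toLinearMap = ℬ n) {n : ℤ} {a : A} : σ a ∈ ℬ n ↔ a ∈ 𝒜 n := by
  rw [← hσgr]
  exact σ.injective.mem_set_image

variable {K A B : Type} [Field K] [Ring A] [Algebra K A] [Ring B] [Algebra K B]
  {𝒜 : ℤ → Submodule K A} [GradedAlgebra 𝒜] {ℬ : ℤ → Submodule K B} [GradedAlgebra ℬ]

theorem negOne_uzpow_smul {M : Type*} [AddCommGroup M] [Module K M] (n : ℤ) (x : M) :
    ((-1 : ℤˣ) ^ n) • x = (-1 : K) ^ n • x := by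
  obtain hn | hn := Int.even_or_odd n
  · rw [hn.neg_one_zpow, hn.neg_one_zpow, one_smul, one_smul]
  · rw [hn.neg_one_zpow, hn.neg_one_zpow, neg_one_smul K, Units.neg_smul, one_smul]

variable (𝒜) in
/-- The right action of the Koszul opposite `B` of `A` on `A` as an algebra homomorphism. -/
noncomputable def koszulOpAction (σ : A ≃ₗ[K] B) (hσ1 : σ 1 = 1)
    (hσmul : ∀ m n : ℤ, ∀ a ∈ 𝒜 m, ∀ b ∈ 𝒜 n,
      σ a * σ b = ((-1 : K) ^ (m.natAbs * n.natAbs)) • σ (b * a)) : B →ₐ[K] Module.End K A :=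
  AlgHom.ofLinearMap (signedMulRight 𝒜 ∘ₗ σ.symm.toLinearMap)
    (by
      have h : σ.symm 1 = 1 := by rw [← hσ1, σ.symm_apply_apply]
      ext x
      simp [h, signedMulRight_of_mem (SetLike.one_mem_graded 𝒜)])
    (fun b c => by
      obtain ⟨a, rfl⟩ := σ.surjective b
      obtain ⟨a', rfl⟩ := σ.surjective c
      suffices ((LinearMap.mul K B).compl₁₂ σ.toLinearMap σ.toLinearMap).compr₂
            (signedMulRight 𝒜 ∘ₗ σ.symm.toLinearMap) =
          (LinearMap.mul K (Module.End K A)).compl₁₂ (signedMulRight 𝒜) (signedMulRight 𝒜) by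
        simpa using! LinearMap.congr_fun₂ this a a'
      refine LinearMap.ext_homogeneous 𝒜 fun m a ha =>
        LinearMap.ext_homogeneous 𝒜 fun n b hb => LinearMap.ext_homogeneous 𝒜 fun k x hx => ?_
      have hba := SetLike.mul_mem_graded hb ha
      have hxb := SetLike.mul_mem_graded hx hb
      simp [hσmul m n a ha b hb, neg_one_pow_natAbs_mul, signedMulRight_of_mem_of_mem hba hx,
        signedMulRight_of_mem_of_mem hb hx, signedMulRight_of_mem_of_mem ha hxb, smul_smul,
        ← zpow_add₀, mul_assoc]
      congr 2
      ring)

theorem koszulOpAction_apply (σ : A ≃ₗ[K] B) (hσ1 : σ 1 = 1)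
    (hσmul : ∀ m n : ℤ, ∀ a ∈ 𝒜 m, ∀ b ∈ 𝒜 n,
      σ a * σ b = ((-1 : K) ^ (m.natAbs * n.natAbs)) • σ (b * a)) (a : A) :
    koszulOpAction 𝒜 σ hσ1 hσmul (σ a) = signedMulRight 𝒜 a := by
  simp [koszulOpAction]

variable (𝒜 ℬ) in
/-- The two-sided action of `A` and its Koszul opposite on `A`. -/
noncomputable def koszulTwoSided (σ : A ≃ₗ[K] B) (hσ1 : σ 1 = 1)
    (hσgr : ∀ n : ℤ, (𝒜 n).map σ.toLinearMap = ℬ n)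
    (hσmul : ∀ m n : ℤ, ∀ a ∈ 𝒜 m, ∀ b ∈ 𝒜 n,
      σ a * σ b = ((-1 : K) ^ (m.natAbs * n.natAbs)) • σ (b * a)) :
    (𝒜 ᵍ⊗[K] ℬ) →ₐ[K] Module.End K A :=
  GradedTensorProduct.lift 𝒜 ℬ (Algebra.lmul K A) (koszulOpAction 𝒜 σ hσ1 hσmul) (by
    rintro i j ⟨a, ha⟩ ⟨b, hb⟩
    obtain ⟨b, rfl⟩ := σ.surjective b
    rw [apply_mem_iff_of_map_eq hσgr] at hb
    rw [negOne_uzpow_smul (K := K)]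
    refine LinearMap.ext_homogeneous 𝒜 fun k x hx => ?_
    have hax := SetLike.mul_mem_graded ha hx
    simp [koszulOpAction_apply, signedMulRight_of_mem_of_mem hb hx,
      signedMulRight_of_mem_of_mem hb hax, smul_smul, ← zpow_add₀, mul_assoc]
    rw [show j * i + (i + k) * j = k * j + (i * j + i * j) by ring, zpow_add₀ (by simp),
      zpow_add₀ (by simp), neg_one_zpow_mul_self, mul_one])

section

variable {σ : A ≃ₗ[K] B} {hσ1 : σ 1 = 1} {hσgr : ∀ n : ℤ, (𝒜 n).map σ.toLinearMap = ℬ n}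
  {hσmul : ∀ m n : ℤ, ∀ a ∈ 𝒜 m, ∀ b ∈ 𝒜 n,
    σ a * σ b = ((-1 : K) ^ (m.natAbs * n.natAbs)) • σ (b * a)}

theorem koszulTwoSided_tmul (a b : A) :
    koszulTwoSided 𝒜 ℬ σ hσ1 hσgr hσmul (a ᵍ⊗ₜ[K] σ b) =
      LinearMap.mulLeft K a * signedMulRight 𝒜 b := by
  rw [← koszulOpAction_apply σ hσ1 hσmul]
  rfl

theorem koszulTwoSided_tmul_apply {j k : ℤ} (a : A) {b x : A} (hb : b ∈ 𝒜 j) (hx : x ∈ 𝒜 k) :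
    koszulTwoSided 𝒜 ℬ σ hσ1 hσgr hσmul (a ᵍ⊗ₜ[K] σ b) x =
      (-1 : K) ^ (k * j) • (a * x * b) := by
  simp [koszulTwoSided_tmul, signedMulRight_of_mem_of_mem hb hx, mul_assoc]

/-- Linear maps out of a graded tensor product with a Koszul opposite agree if they agree on
tensors of homogeneous elements. -/
theorem GradedTensorProduct.ext_homogeneous (σ : A ≃ₗ[K] B) {M : Type*} [AddCommGroup M]
    [Module K M] {f g : (𝒜 ᵍ⊗[K] ℬ) →ₗ[K] M}
    (h : ∀ i, ∀ a ∈ 𝒜 i, ∀ j, ∀ b ∈ 𝒜 j, f (a ᵍ⊗ₜ[K] σ b) = g (a ᵍ⊗ₜ[K] σ b)) : f = g := by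
  refine GradedTensorProduct.hom_ext 𝒜 ℬ (TensorProduct.ext ?_)
  refine LinearMap.ext_homogeneous 𝒜 fun i a ha => ?_
  have : ((TensorProduct.mk K A B).compr₂ (f ∘ₗ (GradedTensorProduct.of K 𝒜 ℬ).toLinearMap) a) ∘ₗ
        σ.toLinearMap =
      ((TensorProduct.mk K A B).compr₂ (g ∘ₗ (GradedTensorProduct.of K 𝒜 ℬ).toLinearMap) a) ∘ₗ
        σ.toLinearMap :=
    LinearMap.ext_homogeneous 𝒜 fun j b hb => h i a ha j b hb
  refine LinearMap.ext fun b => ?_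
  obtain ⟨b, rfl⟩ := σ.surjective b
  exact LinearMap.congr_fun this b

theorem koszulTwoSided_bijective [FiniteDimensional K A] [Algebra.IsCentral K A]
    [IsSimpleRing A] : Function.Bijective (koszulTwoSided 𝒜 ℬ σ hσ1 hσgr hσmul) := by
  have hfin : FiniteDimensional K B := Module.Finite.equiv σ
  have hfin' : FiniteDimensional K (𝒜 ᵍ⊗[K] ℬ) :=
    Module.Finite.equiv (GradedTensorProduct.of K 𝒜 ℬ)
  have htop : (koszulTwoSided 𝒜 ℬ σ hσ1 hσgr hσmul).range = ⊤ := by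
    refine eq_top_of_signedMulRight_mem (𝒜 := 𝒜) _ (fun a => ⟨a ᵍ⊗ₜ[K] σ 1, ?_⟩)
      (fun a => ⟨1 ᵍ⊗ₜ[K] σ a, ?_⟩)
    · refine (koszulTwoSided_tmul a 1).trans ?_
      rw [signedMulRight_of_even Even.zero (SetLike.one_mem_graded 𝒜), LinearMap.mulRight_one]
      rfl
    · refine (koszulTwoSided_tmul 1 a).trans ?_
      rw [LinearMap.mulLeft_one]
      rfl
  have hsurj := (AlgHom.range_eq_top _).1 htop
  refine ⟨(LinearMap.injective_iff_surjective_of_finrank_eq_finrank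
    (f := (koszulTwoSided 𝒜 ℬ σ hσ1 hσgr hσmul).toLinearMap) ?_).2 hsurj, hsurj⟩
  rw [← (GradedTensorProduct.of K 𝒜 ℬ).finrank_eq, Module.finrank_linearMap,
    Module.finrank_tensorProduct, σ.finrank_eq]

theorem koszulTwoSided_mem_endGrading {i j : ℤ} {a b : A} (ha : a ∈ 𝒜 i) (hb : b ∈ 𝒜 j) :
    koszulTwoSided 𝒜 ℬ σ hσ1 hσgr hσmul (a ᵍ⊗ₜ[K] σ b) ∈ endGrading K 𝒜 (i + j) := by
  intro k x hx
  rw [koszulTwoSided_tmul_apply a hb hx]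
  refine Submodule.smul_mem _ _ ?_
  have := SetLike.mul_mem_graded (SetLike.mul_mem_graded ha hx) hb
  rwa [show i + k + j = k + (i + j) by ring] at this

/-- Every element of the graded tensor product has a homogeneous component of each degree, acting
as the homogeneous component of the two-sided action. -/
theorem exists_mem_gtGrading_koszulTwoSided_eq (n : ℤ) (t : 𝒜 ᵍ⊗[K] ℬ) :
    ∃ s ∈ gtGrading K 𝒜 ℬ n, ∀ k, ∀ x ∈ 𝒜 k,
      koszulTwoSided 𝒜 ℬ σ hσ1 hσgr hσmul s x =
        GradedRing.proj 𝒜 (k + n) (koszulTwoSided 𝒜 ℬ σ hσ1 hσgr hσmul t x) := by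
  obtain ⟨t, rfl⟩ := (GradedTensorProduct.of K 𝒜 ℬ).surjective t
  induction t using TensorProduct.induction_on with
  | zero => exact ⟨0, zero_mem _, fun k x _ => by simp⟩
  | add t₁ t₂ h₁ h₂ =>
    obtain ⟨s₁, hs₁, h₁⟩ := h₁
    obtain ⟨s₂, hs₂, h₂⟩ := h₂
    exact ⟨s₁ + s₂, add_mem hs₁ hs₂, fun k x hx => by simp [h₁ k x hx, h₂ k x hx]⟩
  | tmul a b =>
    obtain ⟨b, rfl⟩ := σ.surjective b
    induction a using DirectSum.Decomposition.inductionOn 𝒜 with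
    | zero => exact ⟨0, zero_mem _, fun k x _ => by simp⟩
    | add a₁ a₂ h₁ h₂ =>
      obtain ⟨s₁, hs₁, h₁⟩ := h₁
      obtain ⟨s₂, hs₂, h₂⟩ := h₂
      exact ⟨s₁ + s₂, add_mem hs₁ hs₂, fun k x hx => by
        simp [h₁ k x hx, h₂ k x hx, TensorProduct.add_tmul]⟩
    | @homogeneous i a =>
      induction b using DirectSum.Decomposition.inductionOn 𝒜 with
      | zero => exact ⟨0, zero_mem _, fun k x _ => by simp⟩
      | add b₁ b₂ h₁ h₂ =>
        obtain ⟨s₁, hs₁, h₁⟩ := h₁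
        obtain ⟨s₂, hs₂, h₂⟩ := h₂
        exact ⟨s₁ + s₂, add_mem hs₁ hs₂, fun k x hx => by
          simp [h₁ k x hx, h₂ k x hx, TensorProduct.tmul_add]⟩
      | @homogeneous j b =>
        by_cases hn : i + j = n
        · subst hn
          refine ⟨_, Submodule.subset_span
            ⟨i, j, rfl, a, a.2, σ b, (apply_mem_iff_of_map_eq hσgr).2 b.2, rfl⟩, fun k x hx => ?_⟩
          rw [GradedRing.proj_apply, DirectSum.decompose_of_mem_same]
          exact koszulTwoSided_mem_endGrading a.2 b.2 k x hx
        · refine ⟨0, zero_mem _, fun k x hx => ?_⟩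
          rw [GradedRing.proj_apply, DirectSum.decompose_of_mem_ne 𝒜
            (koszulTwoSided_mem_endGrading a.2 b.2 k x hx) (by simpa using hn)]
          simp

theorem map_koszulTwoSided_gtGrading [FiniteDimensional K A] [Algebra.IsCentral K A]
    [IsSimpleRing A] (n : ℤ) :
    (gtGrading K 𝒜 ℬ n).map (koszulTwoSided 𝒜 ℬ σ hσ1 hσgr hσmul).toLinearMap =
      endGrading K 𝒜 n := by
  apply le_antisymm
  · rw [gtGrading, Submodule.map_span_le]
    rintro _ ⟨i, j, rfl, a, ha, b, hb, rfl⟩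
    obtain ⟨b, rfl⟩ := σ.surjective b
    exact koszulTwoSided_mem_endGrading (hσgr := hσgr) ha ((apply_mem_iff_of_map_eq hσgr).1 hb)
  · intro f hf
    obtain ⟨t, rfl⟩ := (koszulTwoSided_bijective (𝒜 := 𝒜) (ℬ := ℬ) (σ := σ) (hσ1 := hσ1)
      (hσgr := hσgr) (hσmul := hσmul)).2 f
    obtain ⟨s, hs, h⟩ := exists_mem_gtGrading_koszulTwoSided_eq (hσ1 := hσ1) (hσgr := hσgr)
      (hσmul := hσmul) n t
    refine ⟨s, hs, LinearMap.ext_homogeneous 𝒜 fun k x hx => ?_⟩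
    refine (h k x hx).trans ?_
    rw [GradedRing.proj_apply, DirectSum.decompose_of_mem_same 𝒜 (hf k x hx)]

theorem koszulTwoSided_gtDiff {d : A →ₗ[K] A} (hA : IsDGAlgebra 𝒜 d) {dB : B →ₗ[K] B}
    (hσd : ∀ a : A, σ (d a) = dB (σ a)) (t : 𝒜 ᵍ⊗[K] ℬ) :
    koszulTwoSided 𝒜 ℬ σ hσ1 hσgr hσmul (gtDiff K 𝒜 ℬ d dB t) =
      endDiff K 𝒜 d (koszulTwoSided 𝒜 ℬ σ hσ1 hσgr hσmul t) := by
  suffices (koszulTwoSided 𝒜 ℬ σ hσ1 hσgr hσmul).toLinearMap ∘ₗ gtDiff K 𝒜 ℬ d dB =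
      endDiff K 𝒜 d ∘ₗ (koszulTwoSided 𝒜 ℬ σ hσ1 hσgr hσmul).toLinearMap from
    LinearMap.congr_fun this t
  refine GradedTensorProduct.ext_homogeneous σ fun i a ha j b hb =>
    LinearMap.ext_homogeneous 𝒜 fun k x hx => ?_
  have hd : gtDiff K 𝒜 ℬ d dB (a ᵍ⊗ₜ[K] σ b) =
      d a ᵍ⊗ₜ[K] σ b + (-1 : K) ^ i • a ᵍ⊗ₜ[K] σ (d b) := by
    simp only [gtDiff, LinearMap.comp_apply, LinearEquiv.coe_coe, LinearMap.add_apply,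
      GradedTensorProduct.of_symm_of, TensorProduct.map_tmul, signOp_of_mem ha, hσd,
      LinearMap.id_apply, ← TensorProduct.smul_tmul', map_add, map_smul]
  have hdx := hA.map_mem k x hx
  have hmem := koszulTwoSided_mem_endGrading (σ := σ) (ℬ := ℬ) (hσ1 := hσ1) (hσgr := hσgr)
    (hσmul := hσmul) ha hb _ _ hdx
  have hL : koszulTwoSided 𝒜 ℬ σ hσ1 hσgr hσmul (gtDiff K 𝒜 ℬ d dB (a ᵍ⊗ₜ[K] σ b)) x =
      (-1 : K) ^ (k * j) • (d a * x * b) + (-1 : K) ^ i • (-1 : K) ^ (k * (j + 1)) •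
        (a * x * d b) := by
    rw [hd, map_add, map_smul, LinearMap.add_apply, LinearMap.smul_apply,
      koszulTwoSided_tmul_apply _ hb hx, koszulTwoSided_tmul_apply _ (hA.map_mem j b hb) hx]
  have hR : endDiff K 𝒜 d (koszulTwoSided 𝒜 ℬ σ hσ1 hσgr hσmul (a ᵍ⊗ₜ[K] σ b)) x =
      (-1 : K) ^ (k * j) • d (a * x * b) -
        (-1 : K) ^ (k + 1) • (-1 : K) ^ (k + 1 + (i + j)) • (-1 : K) ^ ((k + 1) * j) •
          (a * d x * b) := by
    change d (koszulTwoSided 𝒜 ℬ σ hσ1 hσgr hσmul (a ᵍ⊗ₜ[K] σ b) x) -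
      signOp K 𝒜 (koszulTwoSided 𝒜 ℬ σ hσ1 hσgr hσmul (a ᵍ⊗ₜ[K] σ b) (signOp K 𝒜 (d x))) = _
    rw [signOp_of_mem hdx, map_smul, map_smul, signOp_of_mem hmem,
      koszulTwoSided_tmul_apply _ hb hx, koszulTwoSided_tmul_apply _ hb hdx, map_smul]
  refine hL.trans (Eq.trans ?_ hR.symm)
  rw [hA.leibniz _ _ _ (SetLike.mul_mem_graded ha hx) _ hb, hA.leibniz _ _ _ ha _ hx,
    neg_one_pow_natAbs, neg_one_pow_natAbs]
  have h0 : (-1 : K) ≠ 0 := by simp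
  have hj := neg_one_zpow_mul_self (K := K) j
  have hk := neg_one_zpow_mul_self (K := K) k
  simp only [add_mul, mul_add, mul_one, one_mul, zpow_add₀ h0, zpow_one, smul_mul_assoc, smul_add,
    smul_smul]
  have h1 : (-1 : K) ^ k * -1 * ((-1 : K) ^ k * -1 * ((-1 : K) ^ i * (-1 : K) ^ j)) *
      ((-1 : K) ^ (k * j) * (-1 : K) ^ j) = (-1 : K) ^ (k * j) * (-1 : K) ^ i := by
    linear_combination (-1 : K) ^ (k * j) * (-1 : K) ^ i * (hk * (-1 : K) ^ j * (-1 : K) ^ j + hj)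
  have h1' : (-1 : K) ^ k * -1 * ((-1 : K) ^ k * -1 * ((-1 : K) ^ i * (-1 : K) ^ j) *
      ((-1 : K) ^ (k * j) * (-1 : K) ^ j)) = (-1 : K) ^ (k * j) * (-1 : K) ^ i := by
    rw [← mul_assoc, h1]
  rw [h1']
  module

end

end KoszulOpposite

/-- Let `(A, 𝒜, d)` be a dg `K`-algebra which is finite-dimensional and
central simple as a `K`-algebra, and let `(B, ℬ, dB)` be (a realization of) its Koszul
opposite dg algebra `(Aᵒᵖ, d)`, witnessed by `σ`.  Then `A ⊗_K Aᵒᵖ ≅ End•_K(A)` as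
differential graded `K`-algebras, where `A` is regarded as the underlying bounded complex
of finite-dimensional `K`-vector spaces; in particular `A ⊗_K Aᵒᵖ` is isomorphic as a dg
`K`-algebra to `Mat_{dim_K A}(K)` with some grading and differential. -/
theorem tensor_op_iso_end (K A B : Type) [Field K] [Ring A] [Algebra K A]
    [FiniteDimensional K A] [Ring B] [Algebra K B]
    (𝒜 : ℤ → Submodule K A) [GradedAlgebra 𝒜] (d : A →ₗ[K] A) (hA : IsDGAlgebra 𝒜 d)
    [Algebra.IsCentral K A] [IsSimpleRing A]
    (ℬ : ℤ → Submodule K B) [GradedAlgebra ℬ] (dB : B →ₗ[K] B) (hB : IsDGAlgebra ℬ dB)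
    (σ : A ≃ₗ[K] B) (hσ1 : σ 1 = 1)
    (hσgr : ∀ n : ℤ, (𝒜 n).map σ.toLinearMap = ℬ n)
    (hσd : ∀ a : A, σ (d a) = dB (σ a))
    (hσmul : ∀ m n : ℤ, ∀ a ∈ 𝒜 m, ∀ b ∈ 𝒜 n,
      σ a * σ b = ((-1 : K) ^ (m.natAbs * n.natAbs)) • σ (b * a)) :
    (∃ e : (𝒜 ᵍ⊗[K] ℬ) ≃ₐ[K] Module.End K A,
      IsDGIso (gtGrading K 𝒜 ℬ) (endGrading K 𝒜) (gtDiff K 𝒜 ℬ d dB) (endDiff K 𝒜 d) e) ∧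
    ∃ (ℳ : ℤ → Submodule K
        (Matrix (Fin (Module.finrank K A)) (Fin (Module.finrank K A)) K))
      (dM : Matrix (Fin (Module.finrank K A)) (Fin (Module.finrank K A)) K →ₗ[K]
        Matrix (Fin (Module.finrank K A)) (Fin (Module.finrank K A)) K)
      (e : (𝒜 ᵍ⊗[K] ℬ) ≃ₐ[K]
        Matrix (Fin (Module.finrank K A)) (Fin (Module.finrank K A)) K),
      IsDGIso (gtGrading K 𝒜 ℬ) ℳ (gtDiff K 𝒜 ℬ d dB) dM e := by
  let e : (𝒜 ᵍ⊗[K] ℬ) ≃ₐ[K] Module.End K A :=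
    AlgEquiv.ofBijective (koszulTwoSided 𝒜 ℬ σ hσ1 hσgr hσmul) koszulTwoSided_bijective
  have he : IsDGIso (gtGrading K 𝒜 ℬ) (endGrading K 𝒜) (gtDiff K 𝒜 ℬ d dB) (endDiff K 𝒜 d) e :=
    ⟨map_koszulTwoSided_gtGrading (hσgr := hσgr), koszulTwoSided_gtDiff (hσgr := hσgr) hA hσd⟩
  refine ⟨⟨e, he⟩, ?_⟩
  let m := e.trans (LinearMap.toMatrixAlgEquiv (Module.finBasis K A))
  exact ⟨fun n => (gtGrading K 𝒜 ℬ n).map (m : (𝒜 ᵍ⊗[K] ℬ) →ₗ[K] _),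
    m.toLinearMap ∘ₗ gtDiff K 𝒜 ℬ d dB ∘ₗ m.symm.toLinearMap, m, fun _ => rfl,
    fun a => by simp⟩
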